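/- Under the stated assumptions on the Hermitian-matrix-valued solution g of the elliptic system, there is a constant C depending only on n, α, σ, Λ and M such that ∫_{B_{3/4}} |Dg|² dx ≤ C, where |Dg|² denotes the sum of the squared absolute values of all first-order (real) partial derivatives of all entries g_{ij̄}, and dx is Lebesgue measure on ℂⁿ ≅ ℝ^{2n}. -/

import Mathlib

open Matrix MeasureTheory

noncomputable instance (n : ℕ) : MeasurableSpace (EuclideanSpace ℂ (Fin n)) := borel _
instance (n : ℕ) : BorelSpace (EuclideanSpace ℂ (Fin n)) := ⟨rfl⟩

/-- The real partial derivative `∂_{x_k} f` (direction of the real part of `z_k`). -/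
noncomputable def pdx (n : ℕ) (k : Fin n) (f : EuclideanSpace ℂ (Fin n) → ℂ)
    (z : EuclideanSpace ℂ (Fin n)) : ℂ :=
  fderiv ℝ f z (EuclideanSpace.single k (1 : ℂ))

/-- The real partial derivative `∂_{y_k} f` (direction of the imaginary part of `z_k`). -/
noncomputable def pdy (n : ℕ) (k : Fin n) (f : EuclideanSpace ℂ (Fin n) → ℂ)
    (z : EuclideanSpace ℂ (Fin n)) : ℂ :=
  fderiv ℝ f z (EuclideanSpace.single k Complex.I)

/-- The Wirtinger derivative `∂_k = ½(∂_{x_k} − i ∂_{y_k})`. -/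
noncomputable def wirt (n : ℕ) (k : Fin n) (f : EuclideanSpace ℂ (Fin n) → ℂ)
    (z : EuclideanSpace ℂ (Fin n)) : ℂ :=
  (pdx n k f z - Complex.I * pdy n k f z) / 2

/-- The conjugate Wirtinger derivative `∂_{k̄} = ½(∂_{x_k} + i ∂_{y_k})`. -/
noncomputable def wirtBar (n : ℕ) (k : Fin n) (f : EuclideanSpace ℂ (Fin n) → ℂ)
    (z : EuclideanSpace ℂ (Fin n)) : ℂ :=
  (pdx n k f z + Complex.I * pdy n k f z) / 2

/-- The hypotheses on the Hermitian-matrix-valued solution `g` of the elliptic system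
`g^{kl̄} ∂_k ∂_{l̄} g_{ij̄} − g^{km̄} g^{pl̄} (∂_p g_{im̄})(∂_{l̄} g_{kj̄}) = c g_{ij̄} + H_{ij̄}`
on the unit ball `B₁ ⊆ ℂⁿ`:
smoothness of `g`, pointwise Hermitianity, the two-sided bound `σ⁻¹·Id ≤ g ≤ σ·Id`,
continuity of `H` together with `|c| + sup |H| ≤ Λ`, the `α`-Hölder bound `M` for `g`,
and the equation itself (with `g^{kl̄}` the entries of the pointwise inverse matrix). -/
def EllipticSolution (n : ℕ) (α σ Λ M c : ℝ)
    (g H : EuclideanSpace ℂ (Fin n) → Matrix (Fin n) (Fin n) ℂ) : Prop :=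
  (∀ i j : Fin n, ContDiffOn ℝ (⊤ : ℕ∞) (fun z => g z i j)
      (Metric.ball (0 : EuclideanSpace ℂ (Fin n)) 1)) ∧
  (∀ z ∈ Metric.ball (0 : EuclideanSpace ℂ (Fin n)) 1, (g z).IsHermitian) ∧
  (∀ z ∈ Metric.ball (0 : EuclideanSpace ℂ (Fin n)) 1, ∀ v : Fin n → ℂ,
      σ⁻¹ * (star v ⬝ᵥ v).re ≤ (star v ⬝ᵥ (g z).mulVec v).re ∧
      (star v ⬝ᵥ (g z).mulVec v).re ≤ σ * (star v ⬝ᵥ v).re) ∧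
  (∀ i j : Fin n, ContinuousOn (fun z => H z i j)
      (Metric.ball (0 : EuclideanSpace ℂ (Fin n)) 1)) ∧
  (∀ z ∈ Metric.ball (0 : EuclideanSpace ℂ (Fin n)) 1, ∀ i j : Fin n,
      |c| + ‖H z i j‖ ≤ Λ) ∧
  (∀ i j : Fin n, ∀ z ∈ Metric.ball (0 : EuclideanSpace ℂ (Fin n)) 1,
      ∀ y ∈ Metric.ball (0 : EuclideanSpace ℂ (Fin n)) 1,
      ‖g z i j - g y i j‖ ≤ M * ‖z - y‖ ^ α) ∧
  (∀ z ∈ Metric.ball (0 : EuclideanSpace ℂ (Fin n)) 1, ∀ i j : Fin n,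
      (∑ k : Fin n, ∑ l : Fin n,
        ((g z)⁻¹ l k) * wirt n k (fun w => wirtBar n l (fun w' => g w' i j) w) z)
      - (∑ k : Fin n, ∑ m : Fin n, ∑ p : Fin n, ∑ l : Fin n,
        ((g z)⁻¹ m k) * ((g z)⁻¹ l p) *
          wirt n p (fun w => g w i m) z * wirtBar n l (fun w => g w k j) z)
      = (c : ℂ) * g z i j + H z i j)



section WirtingerCalculus

variable {n : ℕ}

theorem wirt_fun_mul (k : Fin n) {f h : EuclideanSpace ℂ (Fin n) → ℂ}
    {z : EuclideanSpace ℂ (Fin n)} (hf : DifferentiableAt ℝ f z) (hh : DifferentiableAt ℝ h z) :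
    wirt n k (fun w => f w * h w) z = wirt n k f z * h z + f z * wirt n k h z := by
  simp only [wirt, pdx, pdy, fderiv_fun_mul hf hh, _root_.add_apply,
    _root_.smul_apply, smul_eq_mul]
  ring

theorem wirt_fun_sum (k : Fin n) {ι : Type*} (s : Finset ι)
    {f : ι → EuclideanSpace ℂ (Fin n) → ℂ}
    {z : EuclideanSpace ℂ (Fin n)} (hf : ∀ i ∈ s, DifferentiableAt ℝ (f i) z) :
    wirt n k (fun w => ∑ i ∈ s, f i w) z = ∑ i ∈ s, wirt n k (f i) z := by
  simp only [wirt, pdx, pdy, fderiv_fun_sum hf, _root_.sum_apply,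
    Finset.mul_sum, ← Finset.sum_sub_distrib, Finset.sum_div]

theorem wirt_sub_const (k : Fin n) (f : EuclideanSpace ℂ (Fin n) → ℂ) (a : ℂ)
    (z : EuclideanSpace ℂ (Fin n)) :
    wirt n k (fun w => f w - a) z = wirt n k f z := by
  simp only [wirt, pdx, pdy, fderiv_sub_const]

theorem wirt_of_eventuallyEq_const (k : Fin n) {f : EuclideanSpace ℂ (Fin n) → ℂ} {a : ℂ}
    {z : EuclideanSpace ℂ (Fin n)} (h : f =ᶠ[nhds z] fun _ => a) :
    wirt n k f z = 0 := by
  simp [wirt, pdx, pdy, h.fderiv_eq]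

/-- The conjugate Wirtinger derivative of `f` is the conjugate of the Wirtinger derivative of any
function that agrees near the point with the conjugate of `f`. -/
theorem wirtBar_eq_star_wirt (k : Fin n) {f h : EuclideanSpace ℂ (Fin n) → ℂ}
    {z : EuclideanSpace ℂ (Fin n)} (hfh : f =ᶠ[nhds z] fun w => star (h w)) :
    wirtBar n k f z = star (wirt n k h z) := by
  have hfd : fderiv ℝ f z = ((starL' ℝ : ℂ ≃L[ℝ] ℂ) : ℂ →L[ℝ] ℂ).comp (fderiv ℝ h z) := by
    rw [hfh.fderiv_eq]
    exact fderiv_star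
  simp [wirt, wirtBar, pdx, pdy, hfd]

theorem norm_pdx_sq_add_norm_pdy_sq (k : Fin n) (f : EuclideanSpace ℂ (Fin n) → ℂ)
    (z : EuclideanSpace ℂ (Fin n)) :
    ‖pdx n k f z‖ ^ 2 + ‖pdy n k f z‖ ^ 2 =
      2 * (‖wirt n k f z‖ ^ 2 + ‖wirtBar n k f z‖ ^ 2) := by
  simp only [wirt, wirtBar, Complex.sq_norm, Complex.normSq_apply]
  simp
  ring

theorem contDiffOn_wirtBar (k : Fin n) {f : EuclideanSpace ℂ (Fin n) → ℂ}
    {s : Set (EuclideanSpace ℂ (Fin n))} (hs : IsOpen s) (hf : ContDiffOn ℝ (⊤ : ℕ∞) f s) :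
    ContDiffOn ℝ (⊤ : ℕ∞) (wirtBar n k f) s := by
  have h := hf.fderiv_of_isOpen (m := (⊤ : ℕ∞)) hs (by simp)
  have hv (v : EuclideanSpace ℂ (Fin n)) : ContDiffOn ℝ (⊤ : ℕ∞) (fun z => fderiv ℝ f z v) s :=
    h.clm_apply contDiffOn_const
  exact ((hv _).add (contDiffOn_const.mul (hv _))).div_const 2

theorem continuous_wirt (k : Fin n) {f : EuclideanSpace ℂ (Fin n) → ℂ} (hf : ContDiff ℝ 1 f) :
    Continuous (wirt n k f) := by
  have hv (v : EuclideanSpace ℂ (Fin n)) : Continuous (fun z => fderiv ℝ f z v) :=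
    (hf.continuous_fderiv one_ne_zero).clm_apply continuous_const
  exact ((hv _).sub (continuous_const.mul (hv _))).div_const 2

theorem wirt_eq_zero_of_notMem_tsupport (k : Fin n) {f : EuclideanSpace ℂ (Fin n) → ℂ}
    {z : EuclideanSpace ℂ (Fin n)} (hz : z ∉ tsupport f) : wirt n k f z = 0 :=
  wirt_of_eventuallyEq_const (a := 0) k (notMem_tsupport_iff_eventuallyEq.1 hz)

theorem hasCompactSupport_wirt (k : Fin n) {f : EuclideanSpace ℂ (Fin n) → ℂ}
    (hf : HasCompactSupport f) : HasCompactSupport (wirt n k f) :=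
  HasCompactSupport.intro hf fun _ hz => wirt_eq_zero_of_notMem_tsupport k hz

theorem integral_fderiv_apply_eq_zero {f : EuclideanSpace ℂ (Fin n) → ℂ}
    (hf : ContDiff ℝ 1 f) (hs : HasCompactSupport f) (v : EuclideanSpace ℂ (Fin n)) :
    Integrable (fun z => fderiv ℝ f z v) Measure.addHaar ∧
      ∫ z, fderiv ℝ f z v ∂Measure.addHaar = 0 := by
  have hint : Integrable (fun z => fderiv ℝ f z v) Measure.addHaar :=
    ((hf.continuous_fderiv one_ne_zero).clm_apply
      continuous_const).integrable_of_hasCompactSupport (hs.fderiv_apply ℝ v)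
  refine ⟨hint, ?_⟩
  have := integral_mul_fderiv_eq_neg_fderiv_mul_of_integrable (𝕜 := ℂ) (f := fun _ => 1)
    (g := f) (v := v) (μ := (Measure.addHaar : Measure (EuclideanSpace ℂ (Fin n))))
    (by simp) (by simpa using hint)
    (by simpa using hf.continuous.integrable_of_hasCompactSupport hs)
    (fun _ _ => differentiableAt_const _)
    (fun z _ => (hf.differentiable one_ne_zero).differentiableAt)
  simpa using this

theorem integral_wirt_eq_zero (k : Fin n) {f : EuclideanSpace ℂ (Fin n) → ℂ}
    (hf : ContDiff ℝ 1 f) (hs : HasCompactSupport f) :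
    ∫ z, wirt n k f z ∂Measure.addHaar = 0 := by
  obtain ⟨hi, h0⟩ := integral_fderiv_apply_eq_zero hf hs (EuclideanSpace.single k (1 : ℂ))
  obtain ⟨hi', h0'⟩ := integral_fderiv_apply_eq_zero hf hs (EuclideanSpace.single k Complex.I)
  simp only [wirt, pdx, pdy]
  rw [integral_div, integral_sub hi (hi'.const_mul _), integral_const_mul, h0, h0']
  simp

end WirtingerCalculus

section MatrixBounds

variable {n : ℕ}

theorem norm_sum_fin_le {f : Fin n → ℂ} {b : ℝ} (h : ∀ i, ‖f i‖ ≤ b) :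
    ‖∑ i, f i‖ ≤ n * b := by
  simpa using norm_sum_le_of_le Finset.univ fun i _ => h i

theorem star_dotProduct_self_re (v : Fin n → ℂ) : (star v ⬝ᵥ v).re = ∑ i, ‖v i‖ ^ 2 := by
  simp [dotProduct, Complex.sq_norm, Complex.normSq_apply]

/-- A Hermitian form `A` with `0 ≤ A ≤ σ` satisfies `A² ≤ σ A`. -/
theorem normSq_mulVec_le {A : Matrix (Fin n) (Fin n) ℂ} {σ : ℝ} (hσ : 0 < σ)
    (hA : A.IsHermitian)
    (h0 : ∀ v : Fin n → ℂ, 0 ≤ (star v ⬝ᵥ A.mulVec v).re)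
    (h1 : ∀ v : Fin n → ℂ, (star v ⬝ᵥ A.mulVec v).re ≤ σ * (star v ⬝ᵥ v).re) (b : Fin n → ℂ) :
    (star (A.mulVec b) ⬝ᵥ A.mulVec b).re ≤ σ * (star b ⬝ᵥ A.mulVec b).re := by
  set a := A.mulVec b with ha
  have hba : star b ⬝ᵥ A.mulVec a = star a ⬝ᵥ a := by
    rw [dotProduct_mulVec, ← hA.eq, ← star_mulVec]
  have key := h0 ((σ : ℂ) • b - a)
  have hexp : star ((σ : ℂ) • b - a) ⬝ᵥ A.mulVec ((σ : ℂ) • b - a)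
      = (σ : ℂ) * ((σ : ℂ) * (star b ⬝ᵥ a)) - (σ : ℂ) * (star a ⬝ᵥ a)
        - (σ : ℂ) * (star a ⬝ᵥ a) + star a ⬝ᵥ A.mulVec a := by
    simp only [star_sub, star_smul, mulVec_sub, mulVec_smul, sub_dotProduct, dotProduct_sub,
      smul_dotProduct, dotProduct_smul, smul_eq_mul, ← ha, hba, Complex.star_def,
      Complex.conj_ofReal]
    ring
  rw [hexp] at key
  simp only [Complex.add_re, Complex.sub_re, Complex.re_ofReal_mul] at key
  have := h1 a
  have h2 : 0 ≤ σ * (σ * (star b ⬝ᵥ a).re - (star a ⬝ᵥ a).re) := by nlinarith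
  have := nonneg_of_mul_nonneg_right h2 hσ
  linarith

/-- `A` is Hermitian with `σ⁻¹ ≤ A ≤ σ` as forms. -/
structure EllipticMatrix (σ : ℝ) (A : Matrix (Fin n) (Fin n) ℂ) : Prop where
  isHermitian : A.IsHermitian
  lower : ∀ v : Fin n → ℂ, σ⁻¹ * (star v ⬝ᵥ v).re ≤ (star v ⬝ᵥ A.mulVec v).re
  upper : ∀ v : Fin n → ℂ, (star v ⬝ᵥ A.mulVec v).re ≤ σ * (star v ⬝ᵥ v).re

namespace EllipticMatrix

variable {σ : ℝ} {A : Matrix (Fin n) (Fin n) ℂ}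

theorem isUnit_det (hσ : 0 < σ) (hA : EllipticMatrix σ A) : IsUnit A.det := by
  rw [isUnit_iff_ne_zero]
  intro h
  obtain ⟨v, hv, hAv⟩ := Matrix.exists_mulVec_eq_zero_iff.2 h
  have := hA.lower v
  rw [hAv, dotProduct_zero, star_dotProduct_self_re, Complex.zero_re] at this
  have hpos : 0 < ∑ i, ‖v i‖ ^ 2 := by
    obtain ⟨i, hi⟩ := Function.ne_iff.1 hv
    exact Finset.sum_pos' (fun _ _ => sq_nonneg _)
      ⟨i, Finset.mem_univ i, by have := norm_pos_iff.2 hi; positivity⟩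
  have := mul_pos (inv_pos.2 hσ) hpos
  linarith

theorem nonneg (hσ : 0 < σ) (hA : EllipticMatrix σ A) (v : Fin n → ℂ) :
    0 ≤ (star v ⬝ᵥ A.mulVec v).re := by
  refine le_trans ?_ (hA.lower v)
  rw [star_dotProduct_self_re]
  positivity

theorem norm_apply_le (hσ : 0 < σ) (hA : EllipticMatrix σ A) (i j : Fin n) : ‖A i j‖ ≤ σ := by
  have h := normSq_mulVec_le hσ hA.isHermitian (hA.nonneg hσ) hA.upper (Pi.single j 1)
  have h' := hA.upper (Pi.single j 1)
  have e : (star (Pi.single j (1 : ℂ) : Fin n → ℂ) ⬝ᵥ Pi.single j 1).re = 1 := by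
    rw [dotProduct_single]; simp
  rw [e] at h'
  rw [star_dotProduct_self_re] at h
  have h3 : ‖A i j‖ ^ 2 ≤ ∑ k, ‖(A.mulVec (Pi.single j 1)) k‖ ^ 2 := by
    simpa using Finset.single_le_sum (f := fun k => ‖(A.mulVec (Pi.single j 1)) k‖ ^ 2)
      (fun _ _ => sq_nonneg _) (Finset.mem_univ i)
  exact abs_le_of_sq_le_sq' (by nlinarith) hσ.le |>.2

theorem inv_coercive (hσ : 0 < σ) (hA : EllipticMatrix σ A) (a : Fin n → ℂ) :
    σ⁻¹ * ∑ i, ‖a i‖ ^ 2 ≤ (star a ⬝ᵥ A⁻¹.mulVec a).re := by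
  have hu := hA.isUnit_det hσ
  have h := normSq_mulVec_le hσ hA.isHermitian (hA.nonneg hσ) hA.upper (A⁻¹.mulVec a)
  have e : A.mulVec (A⁻¹.mulVec a) = a := by
    rw [mulVec_mulVec, mul_nonsing_inv _ hu, one_mulVec]
  have e2 : (star (A⁻¹.mulVec a) ⬝ᵥ a).re = (star a ⬝ᵥ A⁻¹.mulVec a).re := by
    rw [star_dotProduct, dotProduct_comm]
    simp
  rw [e, e2, star_dotProduct_self_re] at h
  rw [inv_mul_le_iff₀ hσ]
  exact h

theorem norm_inv_apply_le (hσ : 0 < σ) (hA : EllipticMatrix σ A) (i j : Fin n) :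
    ‖A⁻¹ i j‖ ≤ σ := by
  have hu := hA.isUnit_det hσ
  set b := A⁻¹.mulVec (Pi.single j 1) with hb
  have e : A.mulVec b = Pi.single j 1 := by
    rw [hb, mulVec_mulVec, mul_nonsing_inv _ hu, one_mulVec]
  have h := hA.lower b
  rw [e, star_dotProduct_self_re, dotProduct_single, inv_mul_le_iff₀ hσ] at h
  have hre : (star b j * 1).re ≤ ‖b j‖ := by
    simpa using Complex.re_le_norm (b j)
  have hs (k : Fin n) : ‖b k‖ ^ 2 ≤ σ * ‖b j‖ := by
    refine le_trans ?_ (h.trans (by gcongr))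
    exact Finset.single_le_sum (f := fun k => ‖b k‖ ^ 2)
      (fun _ _ => sq_nonneg _) (Finset.mem_univ k)
  have hj : ‖b j‖ ≤ σ := by
    by_contra! hlt
    nlinarith [hs j]
  have hi : ‖b i‖ ≤ σ := abs_le_of_sq_le_sq' (by nlinarith [hs i]) hσ.le |>.2
  simpa [hb] using hi

end EllipticMatrix

end MatrixBounds

section InverseDerivative

variable {n : ℕ}

theorem contDiffOn_det {s : Set (EuclideanSpace ℂ (Fin n))}
    {A : EuclideanSpace ℂ (Fin n) → Matrix (Fin n) (Fin n) ℂ}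
    (hA : ∀ i j, ContDiffOn ℝ (⊤ : ℕ∞) (fun z => A z i j) s) :
    ContDiffOn ℝ (⊤ : ℕ∞) (fun z => (A z).det) s := by
  simp only [Matrix.det_apply']
  exact ContDiffOn.sum fun τ _ => contDiffOn_const.mul (contDiffOn_prod fun i _ => hA _ _)

theorem contDiffOn_inv_apply {s : Set (EuclideanSpace ℂ (Fin n))}
    {A : EuclideanSpace ℂ (Fin n) → Matrix (Fin n) (Fin n) ℂ}
    (hA : ∀ i j, ContDiffOn ℝ (⊤ : ℕ∞) (fun z => A z i j) s)
    (hu : ∀ z ∈ s, IsUnit (A z).det) (i j : Fin n) :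
    ContDiffOn ℝ (⊤ : ℕ∞) (fun z => (A z)⁻¹ i j) s := by
  simp only [Matrix.inv_def, Matrix.smul_apply, Ring.inverse_eq_inv', smul_eq_mul,
    Matrix.adjugate_apply]
  refine ((contDiffOn_det hA).inv fun z hz => (hu z hz).ne_zero).mul (contDiffOn_det fun k l => ?_)
  by_cases h : k = j
  · subst h
    simpa using contDiffOn_const
  · simpa [Matrix.updateRow_ne h] using hA k l

theorem wirt_inv_apply {s : Set (EuclideanSpace ℂ (Fin n))} (hs : IsOpen s)
    {A : EuclideanSpace ℂ (Fin n) → Matrix (Fin n) (Fin n) ℂ}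
    (hA : ∀ i j, ContDiffOn ℝ (⊤ : ℕ∞) (fun z => A z i j) s)
    (hu : ∀ z ∈ s, IsUnit (A z).det) {z : EuclideanSpace ℂ (Fin n)} (hz : z ∈ s)
    (p i j : Fin n) :
    wirt n p (fun w => (A w)⁻¹ i j) z =
      -∑ l, ∑ k, (A z)⁻¹ i k * wirt n p (fun w => A w k l) z * (A z)⁻¹ l j := by
  have hd {f : EuclideanSpace ℂ (Fin n) → ℂ} (hf : ContDiffOn ℝ (⊤ : ℕ∞) f s) :
      DifferentiableAt ℝ f z :=
    (hf.contDiffAt (hs.mem_nhds hz)).differentiableAt (by simp)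
  have hdA (k l) := hd (hA k l)
  have hdI (k l) := hd (contDiffOn_inv_apply hA hu k l)
  have hprod (l : Fin n) : ∑ k, (wirt n p (fun w => (A w)⁻¹ i k) z * A z k l
      + (A z)⁻¹ i k * wirt n p (fun w => A w k l) z) = 0 := by
    have h0 : wirt n p (fun w => ∑ k, (A w)⁻¹ i k * A w k l) z = 0 := by
      refine wirt_of_eventuallyEq_const (a := (1 : Matrix (Fin n) (Fin n) ℂ) i l) p ?_
      filter_upwards [hs.mem_nhds hz] with w hw
      rw [← Matrix.mul_apply, Matrix.nonsing_inv_mul _ (hu w hw)]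
    rw [wirt_fun_sum _ _ fun k _ => (hdI i k).fun_mul (hdA k l)] at h0
    rw [← h0]
    exact Finset.sum_congr rfl fun k _ => (wirt_fun_mul p (hdI i k) (hdA k l)).symm
  have hone (k : Fin n) : ∑ l, A z k l * (A z)⁻¹ l j = (1 : Matrix (Fin n) (Fin n) ℂ) k j := by
    rw [← Matrix.mul_apply, Matrix.mul_nonsing_inv _ (hu z hz)]
  have hsum : ∑ l, (∑ k, (wirt n p (fun w => (A w)⁻¹ i k) z * A z k l
      + (A z)⁻¹ i k * wirt n p (fun w => A w k l) z)) * (A z)⁻¹ l j = 0 := by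
    simp [hprod]
  simp only [Finset.sum_mul, add_mul, Finset.sum_add_distrib] at hsum
  rw [← eq_neg_iff_add_eq_zero] at hsum
  rw [← hsum, Finset.sum_comm]
  simp only [mul_assoc, ← Finset.mul_sum, hone]
  simp [Matrix.one_apply]

theorem norm_wirt_inv_apply_le {s : Set (EuclideanSpace ℂ (Fin n))} (hs : IsOpen s)
    {A : EuclideanSpace ℂ (Fin n) → Matrix (Fin n) (Fin n) ℂ}
    (hA : ∀ i j, ContDiffOn ℝ (⊤ : ℕ∞) (fun z => A z i j) s) {σ t : ℝ} (hσ : 0 < σ)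
    (hell : ∀ z ∈ s, EllipticMatrix σ (A z)) {z : EuclideanSpace ℂ (Fin n)} (hz : z ∈ s)
    (p : Fin n) (ht : ∀ k l, ‖wirt n p (fun w => A w k l) z‖ ≤ t) (i j : Fin n) :
    ‖wirt n p (fun w => (A w)⁻¹ i j) z‖ ≤ n ^ 2 * σ ^ 2 * t := by
  rw [wirt_inv_apply hs hA (fun w hw => (hell w hw).isUnit_det hσ) hz, norm_neg]
  have hI (k l) := (hell z hz).norm_inv_apply_le hσ k l
  have h : ‖∑ l, ∑ k, (A z)⁻¹ i k * wirt n p (fun w => A w k l) z * (A z)⁻¹ l j‖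
      ≤ n * (n * (σ * t * σ)) := by
    refine norm_sum_fin_le fun l => norm_sum_fin_le fun k => ?_
    rw [norm_mul, norm_mul]
    have := (norm_nonneg _).trans (ht k l)
    gcongr
    exacts [hI _ _, ht _ _, hI _ _]
  linarith

end InverseDerivative

section EnergyInequality

variable {n : ℕ}

/-- The algebraic heart of the energy estimate at a single point. Here `G` is the inverse metric,
`w` the oscillation of the metric, `d`, `db` its first derivatives, `dG` the derivatives of the
inverse metric, `S` the second derivatives, and `η`, `dη` the cutoff and its derivatives. -/
theorem energy_inequality_pointwise {σ ε t B K η : ℝ} (hσ : 1 ≤ σ) (ht : 0 ≤ t)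
    (hε : 0 ≤ ε) (hεn : 2 * n ^ 6 * σ ^ 2 * ε ≤ 1 / (16 * σ)) (hB : 0 ≤ B) (hK : 0 ≤ K)
    (hη0 : 0 ≤ η) (hη1 : η ≤ 1)
    {G w : Fin n → Fin n → ℂ} {d db dG : Fin n → Fin n → Fin n → ℂ}
    {S : Fin n → Fin n → Fin n → Fin n → ℂ}
    {R : Fin n → Fin n → ℂ} {dη : Fin n → ℂ}
    (hG : ∀ i j, ‖G i j‖ ≤ σ) (hw : η ≠ 0 → ∀ i j, ‖w i j‖ ≤ ε)
    (hGc : ∀ a : Fin n → ℂ,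
      σ⁻¹ * ∑ i, ‖a i‖ ^ 2 ≤ (∑ p, ∑ l, G l p * a p * star (a l)).re)
    (hd : ∀ p i j, ‖d p i j‖ ≤ t) (hdb : ∀ l i j, db l i j = star (d l j i))
    (hdG : ∀ p i j, ‖dG p i j‖ ≤ n ^ 2 * σ ^ 2 * t) (hdη : ∀ p, ‖dη p‖ ≤ K)
    (hsum : t ^ 2 = 4 * ∑ i, ∑ j, ∑ p, ‖d p j i‖ ^ 2)
    (hR : ∀ i j, ‖R i j‖ ≤ B)
    (heq : ∀ i j, ∑ p, ∑ l, G l p * S p l i j =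
      (∑ k, ∑ m, ∑ p, ∑ l, G m k * G l p * d p i m * db l k j) + R i j) :
    η ^ 2 * t ^ 2 ≤ 8 * σ * ((∑ p, ∑ l, ∑ i, ∑ j,
        ((dη p * η + η * dη p) * (G l p * (w j i * db l i j)) + (η : ℂ) * η *
          (dG p l p * (w j i * db l i j) + G l p * (d p j i * db l i j + w j i * S p l i j)))).re
      + (16 * σ * (n ^ 4 * K * σ * ε) ^ 2 + n ^ 2 * ε * B)) := by
  have hσ0 : 0 < σ := by linarith
  obtain rfl | hη := eq_or_ne η 0
  · simp
    positivity
  have hw := hw hη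
  have hdb' (l i j) : ‖db l i j‖ ≤ t := by rw [hdb, norm_star]; exact hd _ _ _
  set T₁ := ∑ p, ∑ l, ∑ i, ∑ j, dη p * (G l p * (w j i * db l i j)) with hT₁
  set T₂ := ∑ p, ∑ l, ∑ i, ∑ j, dG p l p * (w j i * db l i j) with hT₂
  set T₃ := ∑ i, ∑ j, ∑ p, ∑ l, G l p * d p j i * star (d l j i) with hT₃
  set T₄ := ∑ i, ∑ j, w j i * ∑ p, ∑ l, G l p * S p l i j with hT₄
  have hcomm (f : Fin n → Fin n → Fin n → Fin n → ℂ) :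
      ∑ i, ∑ j, ∑ p, ∑ l, f p l i j = ∑ p, ∑ l, ∑ i, ∑ j, f p l i j := by
    simp_rw [← Fintype.sum_prod_type']
    exact Fintype.sum_equiv ⟨fun x => (x.2.2.1, x.2.2.2, x.1, x.2.1),
      fun x => (x.2.2.1, x.2.2.2, x.1, x.2.1), fun _ => rfl, fun _ => rfl⟩ _ _ fun _ => rfl
  have hsplit : (∑ p, ∑ l, ∑ i, ∑ j,
        ((dη p * η + η * dη p) * (G l p * (w j i * db l i j)) + (η : ℂ) * η *
          (dG p l p * (w j i * db l i j) + G l p * (d p j i * db l i j + w j i * S p l i j))))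
      = ((2 * η : ℝ) : ℂ) * T₁ + ((η ^ 2 : ℝ) : ℂ) * (T₂ + T₃ + T₄) := by
    rw [hT₁, hT₂, hT₃, hT₄, hcomm fun p l i j => G l p * d p j i * star (d l j i)]
    simp only [Finset.mul_sum]
    rw [hcomm fun p l i j => w j i * (G l p * S p l i j)]
    simp only [← Finset.sum_add_distrib, Finset.mul_sum]
    refine Finset.sum_congr rfl fun p _ => Finset.sum_congr rfl fun l _ =>
      Finset.sum_congr rfl fun i _ => Finset.sum_congr rfl fun j _ => ?_
    rw [hdb]
    push_cast
    ring
  have h₁ : ‖T₁‖ ≤ n * (n * (n * (n * (K * (σ * (ε * t)))))) := by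
    refine norm_sum_fin_le fun p => norm_sum_fin_le fun l => norm_sum_fin_le fun i =>
      norm_sum_fin_le fun j => ?_
    simp only [norm_mul]
    gcongr
    exacts [hdη _, hG _ _, hw _ _, hdb' _ _ _]
  have h₂ : ‖T₂‖ ≤ n * (n * (n * (n * ((n ^ 2 * σ ^ 2 * t) * (ε * t))))) := by
    refine norm_sum_fin_le fun p => norm_sum_fin_le fun l => norm_sum_fin_le fun i =>
      norm_sum_fin_le fun j => ?_
    simp only [norm_mul]
    gcongr
    exacts [hdG _ _ _, hw _ _, hdb' _ _ _]
  have h₃ : σ⁻¹ * (t ^ 2 / 4) ≤ T₃.re := by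
    rw [hsum, mul_div_cancel_left₀ _ (by norm_num), Finset.mul_sum, hT₃, Complex.re_sum]
    refine Finset.sum_le_sum fun i _ => ?_
    rw [Finset.mul_sum, Complex.re_sum]
    exact Finset.sum_le_sum fun j _ => hGc fun p => d p j i
  have h₄ : ‖T₄‖ ≤ n * (n * (ε * (n * (n * (n * (n * (σ * σ * t * t)))) + B))) := by
    refine norm_sum_fin_le fun i => norm_sum_fin_le fun j => ?_
    rw [norm_mul, heq]
    gcongr
    · exact hw _ _
    refine (norm_add_le _ _).trans (add_le_add ?_ (hR _ _))
    refine norm_sum_fin_le fun k => norm_sum_fin_le fun m => norm_sum_fin_le fun p =>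
      norm_sum_fin_le fun l => ?_
    simp only [norm_mul]
    gcongr
    exacts [hG _ _, hG _ _, hd _ _ _, hdb' _ _ _]
  have r₁ := (Complex.abs_re_le_norm T₁).trans h₁
  have r₂ := (Complex.abs_re_le_norm T₂).trans h₂
  have r₄ := (Complex.abs_re_le_norm T₄).trans h₄
  rw [hsplit]
  simp only [Complex.add_re, Complex.re_ofReal_mul]
  have q₁ : -(n ^ 4 * K * σ * ε * t) ≤ T₁.re := by
    have := neg_le_of_abs_le r₁
    linarith
  have q₂₄ : -(2 * n ^ 6 * σ ^ 2 * ε * t ^ 2 + n ^ 2 * ε * B) ≤ T₂.re + T₄.re := by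
    have := neg_le_of_abs_le r₂
    have := neg_le_of_abs_le r₄
    linarith
  have q : 2 * n ^ 6 * σ ^ 2 * ε * t ^ 2 ≤ 1 / (16 * σ) * t ^ 2 := by gcongr
  have amgm : 2 * η * (n ^ 4 * K * σ * ε * t) ≤
      1 / (16 * σ) * (η ^ 2 * t ^ 2) + 16 * σ * (n ^ 4 * K * σ * ε) ^ 2 := by
    have hsq : 1 / (16 * σ) * (η ^ 2 * t ^ 2) + 16 * σ * (n ^ 4 * K * σ * ε) ^ 2
        - 2 * η * (n ^ 4 * K * σ * ε * t)
        = 1 / (16 * σ) * (η * t - 16 * σ * (n ^ 4 * K * σ * ε)) ^ 2 := by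
      field_simp
      ring
    have : 0 ≤ 1 / (16 * σ) * (η * t - 16 * σ * (n ^ 4 * K * σ * ε)) ^ 2 := by positivity
    linarith
  have hη2 : η ^ 2 ≤ 1 := pow_le_one₀ hη0 hη1
  have a₁ : -(2 * η * (n ^ 4 * K * σ * ε * t)) ≤ 2 * η * T₁.re := by
    nlinarith
  have a₂ : η ^ 2 * (σ⁻¹ * (t ^ 2 / 4) - (1 / (16 * σ) * t ^ 2 + n ^ 2 * ε * B)) ≤
      η ^ 2 * (T₂.re + T₃.re + T₄.re) := by
    gcongr
    linarith
  have a₃ : η ^ 2 * (n ^ 2 * ε * B) ≤ n ^ 2 * ε * B :=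
    mul_le_of_le_one_left (by positivity) hη2
  have a₄ : η ^ 2 * t ^ 2 = 8 * σ * (σ⁻¹ * (η ^ 2 * t ^ 2) / 8) := by
    field_simp
  rw [a₄]
  gcongr
  have e : 1 / (16 * σ) = σ⁻¹ / 16 := by field_simp
  rw [e] at a₂ amgm
  linarith

end EnergyInequality

section LocalEnergy

variable {n : ℕ}

/-- The squared length of the full real gradient of a matrix-valued function. -/
noncomputable def gradSq (g : EuclideanSpace ℂ (Fin n) → Matrix (Fin n) (Fin n) ℂ)
    (z : EuclideanSpace ℂ (Fin n)) : ℝ :=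
  ∑ i : Fin n, ∑ j : Fin n, ∑ k : Fin n,
    (‖pdx n k (fun w => g w i j) z‖ ^ 2 + ‖pdy n k (fun w => g w i j) z‖ ^ 2)

theorem gradSq_nonneg (g : EuclideanSpace ℂ (Fin n) → Matrix (Fin n) (Fin n) ℂ)
    (z : EuclideanSpace ℂ (Fin n)) : 0 ≤ gradSq g z := by
  unfold gradSq
  positivity

theorem measurable_gradSq (g : EuclideanSpace ℂ (Fin n) → Matrix (Fin n) (Fin n) ℂ) :
    Measurable (gradSq g) := by
  unfold gradSq
  refine Finset.measurable_sum _ fun i _ => Finset.measurable_sum _ fun j _ =>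
    Finset.measurable_sum _ fun k _ => ?_
  exact ((measurable_fderiv_apply_const ℝ _ _).norm.pow_const 2).add
    ((measurable_fderiv_apply_const ℝ _ _).norm.pow_const 2)

theorem wirtBar_apply_eq_star_wirt {s : Set (EuclideanSpace ℂ (Fin n))} (hs : IsOpen s)
    {g : EuclideanSpace ℂ (Fin n) → Matrix (Fin n) (Fin n) ℂ}
    (hg : ∀ z ∈ s, (g z).IsHermitian) {z : EuclideanSpace ℂ (Fin n)} (hz : z ∈ s)
    (l i j : Fin n) :
    wirtBar n l (fun w => g w i j) z = star (wirt n l (fun w => g w j i) z) := by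
  refine wirtBar_eq_star_wirt l ?_
  filter_upwards [hs.mem_nhds hz] with w hw
  exact ((hg w hw).apply i j).symm

theorem gradSq_eq_sum_norm_wirt {s : Set (EuclideanSpace ℂ (Fin n))} (hs : IsOpen s)
    {g : EuclideanSpace ℂ (Fin n) → Matrix (Fin n) (Fin n) ℂ}
    (hg : ∀ z ∈ s, (g z).IsHermitian) {z : EuclideanSpace ℂ (Fin n)} (hz : z ∈ s) :
    gradSq g z = 4 * ∑ i, ∑ j, ∑ p, ‖wirt n p (fun w => g w j i) z‖ ^ 2 := by
  simp only [gradSq, norm_pdx_sq_add_norm_pdy_sq, wirtBar_apply_eq_star_wirt hs hg hz, norm_star,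
    ← Finset.mul_sum, Finset.sum_add_distrib]
  rw [Finset.sum_comm (f := fun i j => ∑ k, ‖wirt n k (fun w => g w i j) z‖ ^ 2)]
  ring

theorem contDiff_mul_of_tsupport_subset {s : Set (EuclideanSpace ℂ (Fin n))} (hs : IsOpen s)
    {χ f : EuclideanSpace ℂ (Fin n) → ℂ} (hχ : ContDiff ℝ (⊤ : ℕ∞) χ) (hχs : tsupport χ ⊆ s)
    (hf : ContDiffOn ℝ (⊤ : ℕ∞) f s) : ContDiff ℝ (⊤ : ℕ∞) fun z => χ z * f z := by
  rw [contDiff_iff_contDiffAt]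
  intro z
  by_cases hz : z ∈ s
  · exact hχ.contDiffAt.mul (hf.contDiffAt (hs.mem_nhds hz))
  · have h0 : (fun z => χ z * f z) =ᶠ[nhds z] fun _ => 0 := by
      filter_upwards [notMem_tsupport_iff_eventuallyEq.1 fun h => hz (hχs h)] with w hw
      simp [hw]
    exact contDiffAt_const.congr_of_eventuallyEq h0

/-- A cutoff function around `x` with support in a given open set, with all the bounds needed. -/
theorem exists_cutoff {s : Set (EuclideanSpace ℂ (Fin n))} {x : EuclideanSpace ℂ (Fin n)}
    (hs : s ∈ nhds x) :
    ∃ (η : EuclideanSpace ℂ (Fin n) → ℝ) (K : ℝ), 0 ≤ K ∧ (∀ z, 0 ≤ η z) ∧ (∀ z, η z ≤ 1) ∧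
      (∀ᶠ z in nhds x, η z = 1) ∧ ContDiff ℝ (⊤ : ℕ∞) (fun z => (η z : ℂ)) ∧
      HasCompactSupport (fun z => (η z : ℂ)) ∧ tsupport (fun z => (η z : ℂ)) ⊆ s ∧
      ∀ p z, ‖wirt n p (fun z => (η z : ℂ)) z‖ ≤ K := by
  obtain ⟨f, hfs, hfc, hf, hfr, hfx⟩ : ∃ f : EuclideanSpace ℂ (Fin n) → ℝ,
      tsupport f ⊆ s ∧ HasCompactSupport f ∧ ContDiff ℝ (⊤ : ℕ∞) f ∧
      (∀ z, 0 ≤ f z ∧ f z ≤ 1) ∧ ∀ᶠ z in nhds x, f z = 1 := by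
    obtain ⟨r, hr, hrs⟩ := Metric.nhds_basis_closedBall.mem_iff.1 hs
    let φ : ContDiffBump x := ⟨r / 2, r, by positivity, by linarith⟩
    exact ⟨φ, by rw [φ.tsupport_eq]; exact hrs, φ.hasCompactSupport, φ.contDiff,
      fun z => ⟨φ.nonneg, φ.le_one⟩, φ.eventuallyEq_one⟩
  have hc : ContDiff ℝ (⊤ : ℕ∞) (fun z => (f z : ℂ)) := Complex.ofRealCLM.contDiff.comp hf
  have hsupp : tsupport (fun z => (f z : ℂ)) ⊆ tsupport f :=
    closure_mono fun z hz => by simpa using hz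
  have hcs : HasCompactSupport (fun z => (f z : ℂ)) := hfc.comp_left (g := Complex.ofReal) rfl
  choose K hK using fun p => (hasCompactSupport_wirt p hcs).exists_bound_of_continuous
    (continuous_wirt p (hc.of_le (by norm_cast)))
  have hK0 (p) : 0 ≤ K p := (norm_nonneg _).trans (hK p x)
  exact ⟨f, ∑ p, K p, Finset.sum_nonneg fun p _ => hK0 p, fun z => (hfr z).1, fun z => (hfr z).2,
    hfx, hc, hcs, hsupp.trans hfs, fun p z => (hK p z).trans
      (Finset.single_le_sum (fun p _ => hK0 p) (Finset.mem_univ p))⟩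

/-- If a nonnegative function is dominated on an open set of finite measure by a constant plus the
real part of the divergence of a vector field compactly supported there, then its integral over
that set is at most the constant times the volume. -/
theorem lintegral_le_of_le_divergence {s : Set (EuclideanSpace ℂ (Fin n))} (hs : MeasurableSet s)
    (hsfin : (Measure.addHaar : Measure (EuclideanSpace ℂ (Fin n))) s ≠ ⊤)
    {F : Fin n → EuclideanSpace ℂ (Fin n) → ℂ} (hF : ∀ p, ContDiff ℝ 1 (F p))
    (hFc : ∀ p, HasCompactSupport (F p)) (hFs : ∀ p, tsupport (F p) ⊆ s)
    {u : EuclideanSpace ℂ (Fin n) → ℝ} (hu : ∀ z, 0 ≤ u z) {a b : ℝ}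
    (h : ∀ z ∈ s, u z ≤ a * ((∑ p, wirt n p (F p) z).re + b)) :
    ∫⁻ z in s, ENNReal.ofReal (u z) ∂Measure.addHaar ≤
      ENNReal.ofReal (a * (b * (Measure.addHaar : Measure (EuclideanSpace ℂ (Fin n))).real s)) := by
  have hint (p) : Integrable (wirt n p (F p)) Measure.addHaar :=
    (continuous_wirt p (hF p)).integrable_of_hasCompactSupport (hasCompactSupport_wirt p (hFc p))
  have hsum : Integrable (fun z => ∑ p, wirt n p (F p) z) Measure.addHaar :=
    integrable_finsetSum _ fun p _ => hint p
  have hzero : ∫ z in s, (∑ p, wirt n p (F p) z).re ∂Measure.addHaar = 0 := by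
    rw [setIntegral_eq_integral_of_forall_compl_eq_zero]
    · have := integral_re hsum
      simp only [RCLike.re_to_complex] at this
      rw [this, integral_finsetSum _ fun p _ => hint p]
      simp [integral_wirt_eq_zero _ (hF _) (hFc _)]
    · intro z hz
      rw [Finset.sum_eq_zero fun p _ =>
        wirt_eq_zero_of_notMem_tsupport p fun hzp => hz (hFs p hzp)]
      rfl
  have hre : IntegrableOn (fun z => (∑ p, wirt n p (F p) z).re) s Measure.addHaar :=
    hsum.re.integrableOn
  have hconst : IntegrableOn (fun _ => b) s
      (Measure.addHaar : Measure (EuclideanSpace ℂ (Fin n))) :=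
    integrableOn_const hsfin
  calc ∫⁻ z in s, ENNReal.ofReal (u z) ∂Measure.addHaar
      ≤ ∫⁻ z in s, ENNReal.ofReal (a * ((∑ p, wirt n p (F p) z).re + b)) ∂Measure.addHaar :=
        setLIntegral_mono' hs fun z hz => ENNReal.ofReal_le_ofReal (h z hz)
    _ = ENNReal.ofReal (∫ z in s, a * ((∑ p, wirt n p (F p) z).re + b) ∂Measure.addHaar) := by
        rw [ofReal_integral_eq_lintegral_ofReal ((hre.fun_add hconst).const_mul a)]
        exact (ae_restrict_iff' hs).2 (.of_forall fun z hz => (hu z).trans (h z hz))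
    _ = _ := by
        rw [integral_const_mul, integral_add hre hconst, hzero, setIntegral_const, zero_add,
          smul_eq_mul, mul_comm b]

theorem EllipticSolution.ellipticMatrix {α σ Λ M c : ℝ}
    {g H : EuclideanSpace ℂ (Fin n) → Matrix (Fin n) (Fin n) ℂ}
    (h : EllipticSolution n α σ Λ M c g H) {z : EuclideanSpace ℂ (Fin n)}
    (hz : z ∈ Metric.ball (0 : EuclideanSpace ℂ (Fin n)) 1) : EllipticMatrix σ (g z) :=
  ⟨h.2.1 z hz, fun v => (h.2.2.1 z hz v).1, fun v => (h.2.2.1 z hz v).2⟩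

theorem le_sum_sum_sum {f : Fin n → Fin n → Fin n → ℝ} (hf : ∀ i j k, 0 ≤ f i j k)
    (i j k : Fin n) : f i j k ≤ ∑ i, ∑ j, ∑ k, f i j k := by
  have h₁ : f i j k ≤ ∑ k, f i j k :=
    Finset.single_le_sum (fun k _ => hf i j k) (Finset.mem_univ k)
  have h₂ : ∑ k, f i j k ≤ ∑ j, ∑ k, f i j k :=
    Finset.single_le_sum (f := fun j => ∑ k, f i j k)
      (fun j _ => Finset.sum_nonneg fun k _ => hf i j k) (Finset.mem_univ j)
  have h₃ : ∑ j, ∑ k, f i j k ≤ ∑ i, ∑ j, ∑ k, f i j k :=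
    Finset.single_le_sum (f := fun i => ∑ j, ∑ k, f i j k)
      (fun i _ => Finset.sum_nonneg fun j _ => Finset.sum_nonneg fun k _ => hf i j k)
      (Finset.mem_univ i)
  exact h₁.trans (h₂.trans h₃)

theorem norm_wirt_le_sqrt_gradSq {s : Set (EuclideanSpace ℂ (Fin n))} (hs : IsOpen s)
    {g : EuclideanSpace ℂ (Fin n) → Matrix (Fin n) (Fin n) ℂ}
    (hg : ∀ z ∈ s, (g z).IsHermitian) {z : EuclideanSpace ℂ (Fin n)} (hz : z ∈ s)
    (p i j : Fin n) : ‖wirt n p (fun w => g w i j) z‖ ≤ √(gradSq g z) := by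
  refine Real.le_sqrt_of_sq_le ?_
  rw [gradSq_eq_sum_norm_wirt hs hg hz]
  have := le_sum_sum_sum (f := fun j i p => ‖wirt n p (fun w => g w i j) z‖ ^ 2)
    (fun _ _ _ => sq_nonneg _) j i p
  have := sq_nonneg ‖wirt n p (fun w => g w i j) z‖
  linarith

/-- The flux of `½ |g - g x|²` with respect to the inverse metric, before summation. -/
noncomputable def oscillationFlux (g : EuclideanSpace ℂ (Fin n) → Matrix (Fin n) (Fin n) ℂ)
    (x : EuclideanSpace ℂ (Fin n)) (p l i j : Fin n) (z : EuclideanSpace ℂ (Fin n)) : ℂ :=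
  (g z)⁻¹ l p * ((g z j i - g x j i) * wirtBar n l (fun w => g w i j) z)

theorem contDiffOn_oscillationFlux {s : Set (EuclideanSpace ℂ (Fin n))} (hs : IsOpen s)
    {g : EuclideanSpace ℂ (Fin n) → Matrix (Fin n) (Fin n) ℂ}
    (hg : ∀ i j, ContDiffOn ℝ (⊤ : ℕ∞) (fun z => g z i j) s)
    (hu : ∀ z ∈ s, IsUnit (g z).det) (x : EuclideanSpace ℂ (Fin n)) (p l i j : Fin n) :
    ContDiffOn ℝ (⊤ : ℕ∞) (oscillationFlux g x p l i j) s :=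
  (contDiffOn_inv_apply hg hu l p).mul
    (((hg j i).sub contDiffOn_const).mul (contDiffOn_wirtBar l hs (hg i j)))

/-- The vector field whose divergence controls the energy: the oscillation flux, cut off. -/
noncomputable def cutoffFlux (ζ : EuclideanSpace ℂ (Fin n) → ℂ)
    (g : EuclideanSpace ℂ (Fin n) → Matrix (Fin n) (Fin n) ℂ)
    (x : EuclideanSpace ℂ (Fin n)) (p : Fin n) (z : EuclideanSpace ℂ (Fin n)) : ℂ :=
  ∑ l, ∑ i, ∑ j, ζ z * ζ z * oscillationFlux g x p l i j z

theorem contDiff_cutoffFlux {s : Set (EuclideanSpace ℂ (Fin n))} (hs : IsOpen s)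
    {g : EuclideanSpace ℂ (Fin n) → Matrix (Fin n) (Fin n) ℂ}
    (hg : ∀ i j, ContDiffOn ℝ (⊤ : ℕ∞) (fun z => g z i j) s)
    (hu : ∀ z ∈ s, IsUnit (g z).det) {ζ : EuclideanSpace ℂ (Fin n) → ℂ}
    (hζ : ContDiff ℝ (⊤ : ℕ∞) ζ) (hζs : tsupport ζ ⊆ s)
    (x : EuclideanSpace ℂ (Fin n)) (p : Fin n) : ContDiff ℝ (⊤ : ℕ∞) (cutoffFlux ζ g x p) :=
  ContDiff.sum fun l _ => ContDiff.sum fun i _ => ContDiff.sum fun j _ =>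
    contDiff_mul_of_tsupport_subset hs (hζ.mul hζ) (tsupport_mul_subset_left.trans hζs)
      (contDiffOn_oscillationFlux hs hg hu x p l i j)

theorem tsupport_cutoffFlux_subset (ζ : EuclideanSpace ℂ (Fin n) → ℂ)
    (g : EuclideanSpace ℂ (Fin n) → Matrix (Fin n) (Fin n) ℂ)
    (x : EuclideanSpace ℂ (Fin n)) (p : Fin n) : tsupport (cutoffFlux ζ g x p) ⊆ tsupport ζ := by
  refine closure_mono fun z hz => ?_
  contrapose! hz
  simp [cutoffFlux, Function.notMem_support.1 hz]

theorem wirt_cutoffFlux {s : Set (EuclideanSpace ℂ (Fin n))} (hs : IsOpen s)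
    {g : EuclideanSpace ℂ (Fin n) → Matrix (Fin n) (Fin n) ℂ}
    (hg : ∀ i j, ContDiffOn ℝ (⊤ : ℕ∞) (fun z => g z i j) s)
    (hu : ∀ z ∈ s, IsUnit (g z).det) {ζ : EuclideanSpace ℂ (Fin n) → ℂ}
    (hζ : Differentiable ℝ ζ) (x : EuclideanSpace ℂ (Fin n))
    {z : EuclideanSpace ℂ (Fin n)} (hz : z ∈ s) (p : Fin n) :
    wirt n p (cutoffFlux ζ g x p) z = ∑ l, ∑ i, ∑ j,
      ((wirt n p ζ z * ζ z + ζ z * wirt n p ζ z) *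
          ((g z)⁻¹ l p * ((g z j i - g x j i) * wirtBar n l (fun w => g w i j) z)) +
        ζ z * ζ z * (wirt n p (fun w => (g w)⁻¹ l p) z *
            ((g z j i - g x j i) * wirtBar n l (fun w => g w i j) z) +
          (g z)⁻¹ l p * (wirt n p (fun w => g w j i) z * wirtBar n l (fun w => g w i j) z +
            (g z j i - g x j i) * wirt n p (wirtBar n l fun w => g w i j) z))) := by
  have hda {f : EuclideanSpace ℂ (Fin n) → ℂ} (hf : ContDiffOn ℝ (⊤ : ℕ∞) f s) :
      DifferentiableAt ℝ f z :=
    (hf.contDiffAt (hs.mem_nhds hz)).differentiableAt (by simp)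
  have hζz : DifferentiableAt ℝ ζ z := hζ z
  have hQ (l i j) : DifferentiableAt ℝ (oscillationFlux g x p l i j) z :=
    hda (contDiffOn_oscillationFlux hs hg hu x p l i j)
  have hd (l i j) : DifferentiableAt ℝ (fun w => ζ w * ζ w * oscillationFlux g x p l i j w) z :=
    (hζz.fun_mul hζz).fun_mul (hQ l i j)
  have hd₁ (l i) : DifferentiableAt ℝ
      (fun w => ∑ j, ζ w * ζ w * oscillationFlux g x p l i j w) z := .fun_sum fun j _ => hd l i j
  have hd₂ (l) : DifferentiableAt ℝ
      (fun w => ∑ i, ∑ j, ζ w * ζ w * oscillationFlux g x p l i j w) z :=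
    .fun_sum fun i _ => hd₁ l i
  unfold cutoffFlux
  rw [wirt_fun_sum p _ fun l _ => hd₂ l]
  refine Finset.sum_congr rfl fun l _ => ?_
  rw [wirt_fun_sum p _ fun i _ => hd₁ l i]
  refine Finset.sum_congr rfl fun i _ => ?_
  rw [wirt_fun_sum p _ fun j _ => hd l i j]
  refine Finset.sum_congr rfl fun j _ => ?_
  have hG := hda (contDiffOn_inv_apply hg hu l p)
  have hw : DifferentiableAt ℝ (fun z => g z j i - g x j i) z :=
    (hda (hg j i)).sub_const _
  have hdb := hda (contDiffOn_wirtBar l hs (hg i j))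
  rw [wirt_fun_mul p (hζz.fun_mul hζz) (hQ l i j), wirt_fun_mul p hζz hζz]
  unfold oscillationFlux
  rw [wirt_fun_mul p hG (hw.fun_mul hdb), wirt_fun_mul p hw hdb, wirt_sub_const]

theorem EllipticSolution.sq_mul_gradSq_le {α σ Λ M c ε K η : ℝ} (hσ : 1 ≤ σ)
    {g H : EuclideanSpace ℂ (Fin n) → Matrix (Fin n) (Fin n) ℂ}
    (h : EllipticSolution n α σ Λ M c g H) (hε : 0 ≤ ε)
    (hεn : 2 * n ^ 6 * σ ^ 2 * ε ≤ 1 / (16 * σ)) (hK : 0 ≤ K)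
    {ζ : EuclideanSpace ℂ (Fin n) → ℂ} (hζ : Differentiable ℝ ζ)
    {x z : EuclideanSpace ℂ (Fin n)} (hx : x ∈ Metric.ball (0 : EuclideanSpace ℂ (Fin n)) 1)
    (hz : z ∈ Metric.ball (0 : EuclideanSpace ℂ (Fin n)) 1) (hζη : ζ z = η) (hη0 : 0 ≤ η)
    (hη1 : η ≤ 1) (hζK : ∀ p, ‖wirt n p ζ z‖ ≤ K) (hosc : η ≠ 0 → M * ‖z - x‖ ^ α ≤ ε) :
    η ^ 2 * gradSq g z ≤ 8 * σ * ((∑ p, wirt n p (cutoffFlux ζ g x p) z).re +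
      (16 * σ * (n ^ 4 * K * σ * ε) ^ 2 + n ^ 2 * ε * (|Λ| * σ + |Λ|))) := by
  have hσ0 : 0 < σ := by linarith
  obtain ⟨hg, hherm, -, -, hΛ, hholder, heq⟩ := id h
  have hbo : IsOpen (Metric.ball (0 : EuclideanSpace ℂ (Fin n)) 1) := Metric.isOpen_ball
  have hell := h.ellipticMatrix hz
  have hd := norm_wirt_le_sqrt_gradSq hbo hherm hz
  have hdiv := Finset.sum_congr rfl fun p (_ : p ∈ Finset.univ) =>
    wirt_cutoffFlux hbo hg (fun w hw => (h.ellipticMatrix hw).isUnit_det hσ0) hζ x hz p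
  have hsq := Real.sq_sqrt (gradSq_nonneg g z)
  rw [hζη] at hdiv
  rw [hdiv, ← hsq]
  refine energy_inequality_pointwise (G := fun i j => (g z)⁻¹ i j) (w := fun i j => g z i j - g x i j)
    (d := fun p i j => wirt n p (fun w => g w i j) z)
    (db := fun l i j => wirtBar n l (fun w => g w i j) z)
    (dG := fun p i j => wirt n p (fun w => (g w)⁻¹ i j) z)
    (S := fun p l i j => wirt n p (wirtBar n l fun w => g w i j) z)
    (R := fun i j => (c : ℂ) * g z i j + H z i j) (dη := fun p => wirt n p ζ z)
    hσ (Real.sqrt_nonneg _) hε hεn (by positivity) hK hη0 hη1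
    (hell.norm_inv_apply_le hσ0) (fun hne i j => (hholder i j z hz x hx).trans (hosc hne))
    (fun a => ?_) hd (wirtBar_apply_eq_star_wirt hbo hherm hz)
    (fun p i j => norm_wirt_inv_apply_le hbo hg hσ0 (fun w hw => h.ellipticMatrix hw) hz p
      (hd p) i j)
    hζK (hsq.trans (gradSq_eq_sum_norm_wirt hbo hherm hz)) (fun i j => ?_) (fun i j => ?_)
  · refine (hell.inv_coercive hσ0 a).trans_eq ?_
    simp only [dotProduct, mulVec, Finset.mul_sum, Pi.star_apply]
    rw [Finset.sum_comm]
    congr 1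
    exact Finset.sum_congr rfl fun p _ => Finset.sum_congr rfl fun l _ => by ring
  · have h₁ := hΛ z hz i j
    have h₂ := hell.norm_apply_le hσ0 i j
    have hcΛ : |c| ≤ |Λ| := by linarith [le_abs_self Λ, norm_nonneg (H z i j)]
    have hHΛ : ‖H z i j‖ ≤ |Λ| := by linarith [le_abs_self Λ, abs_nonneg c]
    refine (norm_add_le _ _).trans (add_le_add ?_ hHΛ)
    rw [norm_mul, Complex.norm_real, Real.norm_eq_abs]
    gcongr
  · rw [← sub_eq_iff_eq_add']
    exact heq z hz i j

theorem exists_local_energy_bound {α σ Λ M : ℝ} (hα0 : 0 < α) (hσ : 1 ≤ σ)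
    {x : EuclideanSpace ℂ (Fin n)} (hx : x ∈ Metric.ball (0 : EuclideanSpace ℂ (Fin n)) 1) :
    ∃ U ∈ nhds x, ∃ C : ℝ, ∀ (c : ℝ)
      (g H : EuclideanSpace ℂ (Fin n) → Matrix (Fin n) (Fin n) ℂ),
      EllipticSolution n α σ Λ M c g H →
      ∫⁻ z in U, ENNReal.ofReal (gradSq g z) ∂Measure.addHaar ≤ ENNReal.ofReal C := by
  have hσ0 : 0 < σ := by linarith
  obtain ⟨ε, hε, hεn⟩ : ∃ ε : ℝ, 0 < ε ∧ 2 * n ^ 6 * σ ^ 2 * ε ≤ 1 / (16 * σ) := by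
    refine ⟨1 / (16 * σ) / (2 * n ^ 6 * σ ^ 2 + 1), by positivity, ?_⟩
    rw [mul_div_assoc', div_le_iff₀ (by positivity), mul_comm]
    gcongr
    linarith
  have hosc : ∀ᶠ z in nhds x, M * ‖z - x‖ ^ α < ε := by
    have hcont : ContinuousAt (fun z => M * ‖z - x‖ ^ α) x :=
      continuousAt_const.mul
        ((continuousAt_id.sub continuousAt_const).norm.rpow_const (.inr hα0.le))
    refine hcont.eventually_lt_const ?_
    simpa [Real.zero_rpow hα0.ne'] using hε
  set b : Set (EuclideanSpace ℂ (Fin n)) := Metric.ball 0 1 with hb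
  have hbo : IsOpen b := Metric.isOpen_ball
  obtain ⟨η, K, hK, hη0, hη1, hηx, hηd, hηc, hηs, hηK⟩ :=
    exists_cutoff (Filter.inter_mem (hbo.mem_nhds hx) hosc)
  set ζ : EuclideanSpace ℂ (Fin n) → ℂ := fun z => (η z : ℂ) with hζ
  set b₀ : ℝ := 16 * σ * (n ^ 4 * K * σ * ε) ^ 2 + n ^ 2 * ε * (|Λ| * σ + |Λ|) with hb₀
  refine ⟨{z | η z = 1} ∩ b, Filter.inter_mem hηx (hbo.mem_nhds hx),
    8 * σ * (b₀ * (Measure.addHaar : Measure (EuclideanSpace ℂ (Fin n))).real b),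
    fun c g H hsol => ?_⟩
  have hζb : tsupport ζ ⊆ b := hηs.trans Set.inter_subset_left
  have hFd (p) : ContDiff ℝ 1 (cutoffFlux ζ g x p) :=
    (contDiff_cutoffFlux hbo hsol.1 (fun z hz => (hsol.ellipticMatrix hz).isUnit_det hσ0)
      hηd hζb x p).of_le (by norm_cast)
  have hFt (p) := tsupport_cutoffFlux_subset ζ g x p
  have hFc (p) : HasCompactSupport (cutoffFlux ζ g x p) :=
    hηc.of_isClosed_subset (isClosed_tsupport _) (hFt p)
  have hmain : ∀ z ∈ b, η z ^ 2 * gradSq g z ≤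
      8 * σ * ((∑ p, wirt n p (cutoffFlux ζ g x p) z).re + b₀) := fun z hz =>
    hsol.sq_mul_gradSq_le hσ hε.le hεn hK (hηd.differentiable (by simp)) hx hz rfl (hη0 z)
      (hη1 z) (fun p => hηK p z)
      fun hne => (hηs (subset_tsupport _ (by simpa [hζ] using hne))).2.le
  calc ∫⁻ z in {z | η z = 1} ∩ b, ENNReal.ofReal (gradSq g z) ∂Measure.addHaar
      ≤ ∫⁻ z in {z | η z = 1} ∩ b, ENNReal.ofReal (η z ^ 2 * gradSq g z) ∂Measure.addHaar := by
        have hη : Continuous η := by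
          exact Complex.continuous_re.comp hηd.continuous
        refine setLIntegral_mono' ((measurableSet_eq_fun hη.measurable measurable_const).inter
          hbo.measurableSet) fun z hz => ?_
        rw [show η z = 1 from hz.1]
        simp
    _ ≤ ∫⁻ z in b, ENNReal.ofReal (η z ^ 2 * gradSq g z) ∂Measure.addHaar :=
        lintegral_mono_set Set.inter_subset_right
    _ ≤ _ := lintegral_le_of_le_divergence hbo.measurableSet measure_ball_lt_top.ne hFd hFc
        (fun p => (hFt p).trans hζb)
        (fun z => mul_nonneg (sq_nonneg _) (gradSq_nonneg g z)) hmain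

end LocalEnergy

/-- energy estimate.  There is a constant `C` depending only on
`n, α, σ, Λ, M` such that `∫_{B_{3/4}} |Dg|² ≤ C`, where `|Dg|²` is the sum of the
squared absolute values of all first-order real partial derivatives of all entries. -/
theorem stmt17 (n : ℕ) (hn : 1 ≤ n) (α σ Λ M : ℝ)
    (hα0 : 0 < α) (hα1 : α < 1) (hσ : 1 ≤ σ) :
    ∃ C : ℝ, ∀ (c : ℝ) (g H : EuclideanSpace ℂ (Fin n) → Matrix (Fin n) (Fin n) ℂ),
      EllipticSolution n α σ Λ M c g H →
      (∫ z in Metric.ball (0 : EuclideanSpace ℂ (Fin n)) (3 / 4),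
        (∑ i : Fin n, ∑ j : Fin n, ∑ k : Fin n,
          (‖pdx n k (fun w => g w i j) z‖ ^ 2 + ‖pdy n k (fun w => g w i j) z‖ ^ 2))
        ∂(Measure.addHaar)) ≤ C := by
  have hK : IsCompact (Metric.closedBall (0 : EuclideanSpace ℂ (Fin n)) (3 / 4)) :=
    isCompact_closedBall _ _
  obtain ⟨C, hC⟩ : ∃ C : ℝ, ∀ (c : ℝ)
      (g H : EuclideanSpace ℂ (Fin n) → Matrix (Fin n) (Fin n) ℂ),
      EllipticSolution n α σ Λ M c g H →
      ∫⁻ z in Metric.closedBall (0 : EuclideanSpace ℂ (Fin n)) (3 / 4),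
        ENNReal.ofReal (gradSq g z) ∂Measure.addHaar ≤ ENNReal.ofReal C := by
    refine hK.induction_on (p := fun s => ∃ C : ℝ, ∀ (c : ℝ)
      (g H : EuclideanSpace ℂ (Fin n) → Matrix (Fin n) (Fin n) ℂ),
      EllipticSolution n α σ Λ M c g H →
      ∫⁻ z in s, ENNReal.ofReal (gradSq g z) ∂Measure.addHaar ≤ ENNReal.ofReal C) ?_ ?_ ?_ ?_
    · exact ⟨0, fun c g H _ => by simp⟩
    · rintro s t hst ⟨C, hC⟩
      exact ⟨C, fun c g H h => (lintegral_mono_set hst).trans (hC c g H h)⟩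
    · rintro s t ⟨C, hC⟩ ⟨D, hD⟩
      refine ⟨max C 0 + max D 0, fun c g H h => (lintegral_union_le _ s t).trans ?_⟩
      rw [ENNReal.ofReal_add (le_max_right _ _) (le_max_right _ _)]
      exact add_le_add
        ((hC c g H h).trans (ENNReal.ofReal_le_ofReal (le_max_left _ _)))
        ((hD c g H h).trans (ENNReal.ofReal_le_ofReal (le_max_left _ _)))
    · intro x hx
      have hx1 : x ∈ Metric.ball (0 : EuclideanSpace ℂ (Fin n)) 1 :=
        Metric.closedBall_subset_ball (by norm_num) hx
      obtain ⟨U, hU, hC⟩ := exists_local_energy_bound (Λ := Λ) (M := M) hα0 hσ hx1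
      exact ⟨U, mem_nhdsWithin_of_mem_nhds hU, hC⟩
  refine ⟨max C 0, fun c g H h => ?_⟩
  change ∫ z in Metric.ball (0 : EuclideanSpace ℂ (Fin n)) (3 / 4), gradSq g z
    ∂Measure.addHaar ≤ max C 0
  rw [integral_eq_lintegral_of_nonneg_ae (.of_forall (gradSq_nonneg g))
    (measurable_gradSq g).aestronglyMeasurable]
  refine ENNReal.toReal_le_of_le_ofReal (le_max_right _ _) ?_
  exact (lintegral_mono_set Metric.ball_subset_closedBall).trans
    ((hC c g H h).trans (ENNReal.ofReal_le_ofReal (le_max_left _ _)))
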